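/- Every Bernoulli congestion game possesses a pure Bayes–Nash equilibrium: there exists a strategy profile s* = (s*_i)_{i∈N} with s*_i ∈ S_i such that C_i(s*) ≤ C_i(s_i, s*_{-i}) for every player i ∈ N and every strategy s_i ∈ S_i. -/

import Mathlib

open Finset

/-- Probability that the set of active players is exactly `I`:
`p(I) = ∏_{j∈I} p_j · ∏_{j∉I} (1 − p_j)`. -/
noncomputable def probOf {ι : Type*} [Fintype ι] [DecidableEq ι]
    (p : ι → ℝ) (I : Finset ι) : ℝ :=
  (∏ j ∈ I, p j) * ∏ j ∈ Iᶜ, (1 - p j)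

/-- Load of resource `e` under the profile `s` when the active set is `I`:
`N_e(s,I) = |{ j ∈ I : e ∈ s_j }|`. -/
def load {ι E : Type*} [DecidableEq E]
    (s : ι → Finset E) (I : Finset ι) (e : E) : ℕ :=
  (I.filter fun j => e ∈ s j).card

/-- Expected cost of player `i`:
`C_i(s) = Σ_{e ∈ s_i} Σ_{I ⊆ N, i ∈ I} p(I) · c_e(N_e(s,I))`. -/
noncomputable def playerCost {ι E : Type*} [Fintype ι] [DecidableEq ι] [DecidableEq E]
    (p : ι → ℝ) (c : E → ℕ → ℝ) (s : ι → Finset E) (i : ι) : ℝ :=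
  ∑ e ∈ s i, ∑ I ∈ (Finset.univ : Finset (Finset ι)).filter (fun I => i ∈ I),
    probOf p I * c e (load s I e)

/-- Expected Rosenthal potential of the profile `s`. -/
noncomputable def expectedPotential {ι E : Type*} [Fintype ι] [DecidableEq ι] [Fintype E]
    [DecidableEq E] (p : ι → ℝ) (c : E → ℕ → ℝ) (s : ι → Finset E) : ℝ :=
  ∑ e, ∑ I : Finset ι, probOf p I * ∑ k ∈ range (load s I e), c e (k + 1)

/-- The part of the expected potential that remains when player `i` is removed from every
active set. -/
noncomputable def residualPotential {ι E : Type*} [Fintype ι] [DecidableEq ι] [Fintype E]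
    [DecidableEq E] (p : ι → ℝ) (c : E → ℕ → ℝ) (s : ι → Finset E) (i : ι) : ℝ :=
  ∑ e, ∑ I : Finset ι, probOf p I * ∑ k ∈ range (load s (I.erase i) e), c e (k + 1)

theorem load_eq_load_erase_add {ι E : Type*} [DecidableEq ι] [DecidableEq E]
    (s : ι → Finset E) (I : Finset ι) (e : E) (i : ι) :
    load s I e = load s (I.erase i) e + if e ∈ s i ∧ i ∈ I then 1 else 0 := by
  unfold load
  rw [filter_erase]
  split_ifs with h
  · exact (card_erase_add_one (mem_filter.2 ⟨h.2, h.1⟩)).symm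
  · rw [erase_eq_of_notMem (fun hi => h (mem_filter.1 hi).symm), add_zero]

theorem load_update_erase {ι E : Type*} [DecidableEq ι] [DecidableEq E]
    (s : ι → Finset E) (I : Finset ι) (e : E) (i : ι) (t : Finset E) :
    load (Function.update s i t) (I.erase i) e = load s (I.erase i) e := by
  unfold load
  congr 1
  refine filter_congr fun j hj => ?_
  rw [Function.update_of_ne (ne_of_mem_erase hj)]

theorem residualPotential_update {ι E : Type*} [Fintype ι] [DecidableEq ι] [Fintype E]
    [DecidableEq E] (p : ι → ℝ) (c : E → ℕ → ℝ) (s : ι → Finset E) (i : ι) (t : Finset E) :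
    residualPotential p c (Function.update s i t) i = residualPotential p c s i := by
  simp only [residualPotential, load_update_erase]

theorem expectedPotential_eq_playerCost_add {ι E : Type*} [Fintype ι] [DecidableEq ι]
    [Fintype E] [DecidableEq E] (p : ι → ℝ) (c : E → ℕ → ℝ) (s : ι → Finset E) (i : ι) :
    expectedPotential p c s = playerCost p c s i + residualPotential p c s i := by
  have hcost : playerCost p c s i =
      ∑ e, ∑ I : Finset ι, if e ∈ s i ∧ i ∈ I then probOf p I * c e (load s I e) else 0 := by
    simp only [playerCost, sum_filter]
    rw [← sum_subset (subset_univ (s i)) fun e _ he => by simp [he]]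
    exact sum_congr rfl fun e he => by simp [he]
  rw [hcost, expectedPotential, residualPotential, ← sum_add_distrib]
  refine sum_congr rfl fun e _ => ?_
  rw [← sum_add_distrib]
  refine sum_congr rfl fun I _ => ?_
  rw [load_eq_load_erase_add s I e i]
  split_ifs
  · rw [sum_range_succ]
    ring
  · simp

/-- Every Bernoulli congestion game possesses a pure Bayes–Nash equilibrium:
a profile `s*` with `s*_i ∈ S_i` such that no player can lower her expected cost
by a unilateral deviation within her strategy set. -/
theorem bernoulli_congestion_exists_equilibrium
    {ι E : Type*} [Fintype ι] [DecidableEq ι] [Fintype E] [DecidableEq E]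
    (S : ι → Finset (Finset E)) (c : E → ℕ → ℝ) (p : ι → ℝ)
    (hS : ∀ i, (S i).Nonempty)
    (hc : ∀ e k, 0 ≤ c e k)
    (hp : ∀ i, p i ∈ Set.Icc (0 : ℝ) 1) :
    ∃ sstar : ι → Finset E, (∀ i, sstar i ∈ S i) ∧
      ∀ i, ∀ si ∈ S i,
        playerCost p c sstar i ≤ playerCost p c (Function.update sstar i si) i := by
  obtain ⟨s, hs, hmin⟩ := (Fintype.piFinset S).exists_min_image (expectedPotential p c)
    (Fintype.piFinset_nonempty.2 hS)
  rw [Fintype.mem_piFinset] at hs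
  refine ⟨s, hs, fun i t ht => ?_⟩
  have hle : expectedPotential p c s ≤ expectedPotential p c (Function.update s i t) := by
    refine hmin _ (Fintype.mem_piFinset.2 fun j => ?_)
    by_cases hj : j = i
    · subst hj
      simpa using ht
    · simpa [hj] using hs j
  rw [expectedPotential_eq_playerCost_add p c s i, expectedPotential_eq_playerCost_add p c _ i,
    residualPotential_update] at hle
  exact le_of_add_le_add_right hle
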